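/- Under the hypotheses of the Brill form computation, the function U satisfies Δ_{ρ,z} U = (1/2) e^{−2U+2α} R − (2/ρ)∂_ρ U + |∇U|²_δ + (ρ²/4) e^{−2α}(∂_z A_ρ − ∂_ρ A_z)² − e^{−2U+2α} K, where R is the scalar curvature of the 3-metric g in Brill form and K is the Gaussian curvature of the quotient metric ĝ = e^{−2U+2α}(dρ²+dz²). -/

import Mathlib

/- STATEMENT 8 (equation (27) of the paper): for the Brill metric g with scalar
curvature R and quotient metric ĝ = e^{−2U+2α}(dρ²+dz²) with Gaussian curvature K:
  Δ_{ρ,z}U = (1/2)e^{−2U+2α}R − (2/ρ)∂_ρU + |∇U|²_δ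
             + (ρ²/4)e^{−2α}(∂_zA_ρ − ∂_ρA_z)² − e^{−2U+2α}K. -/

noncomputable section
open Real

/-- Partial derivative of a function on ℝ³ (coordinates indexed by `Fin 3`). -/
def pd3 (i : Fin 3) (f : (Fin 3 → ℝ) → ℝ) (x : Fin 3 → ℝ) : ℝ :=
  fderiv ℝ f x (Pi.single i 1)

/-- Christoffel symbols Γᵏᵢⱼ of a metric given by its coordinate matrix. -/
def christoffel (g : (Fin 3 → ℝ) → Matrix (Fin 3) (Fin 3) ℝ)
    (k i j : Fin 3) (x : Fin 3 → ℝ) : ℝ :=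
  (1 / 2) * ∑ l, (g x)⁻¹ k l *
    (pd3 i (fun y => g y l j) x + pd3 j (fun y => g y l i) x - pd3 l (fun y => g y i j) x)

/-- Ricci curvature Rᵢⱼ in coordinates. -/
def ricci (g : (Fin 3 → ℝ) → Matrix (Fin 3) (Fin 3) ℝ)
    (i j : Fin 3) (x : Fin 3 → ℝ) : ℝ :=
  (∑ k, pd3 k (christoffel g k i j) x) - (∑ k, pd3 j (christoffel g k i k) x)
  + ∑ k, ∑ l, (christoffel g k k l x * christoffel g l i j x
      - christoffel g k j l x * christoffel g l i k x)

/-- Scalar curvature R = gⁱʲ Rᵢⱼ in coordinates. -/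
def scalarCurv (g : (Fin 3 → ℝ) → Matrix (Fin 3) (Fin 3) ℝ) (x : Fin 3 → ℝ) : ℝ :=
  ∑ i, ∑ j, (g x)⁻¹ i j * ricci g i j x

/-- Partial derivatives and flat Laplacians on the (ρ,z) half plane. -/
def pr (f : ℝ × ℝ → ℝ) (p : ℝ × ℝ) : ℝ := fderiv ℝ f p (1, 0)
def pz (f : ℝ × ℝ → ℝ) (p : ℝ × ℝ) : ℝ := fderiv ℝ f p (0, 1)
def lapRZ (f : ℝ × ℝ → ℝ) (p : ℝ × ℝ) : ℝ := pr (pr f) p + pz (pz f) p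

/-- The Brill metric
g = e^{−2U+2α}(dρ²+dz²) + ρ²e^{−2U}(dφ + A_ρ dρ + A_z dz)²
as a matrix in the coordinates (x 0, x 1, x 2) = (ρ, z, φ). -/
def brillMetric (U α Ar Az : ℝ × ℝ → ℝ) (x : Fin 3 → ℝ) : Matrix (Fin 3) (Fin 3) ℝ :=
  let p : ℝ × ℝ := (x 0, x 1)
  let e2 : ℝ := exp (-2 * U p + 2 * α p)
  let f : ℝ := (x 0) ^ 2 * exp (-2 * U p)
  !![e2 + f * (Ar p) ^ 2, f * Ar p * Az p, f * Ar p;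
     f * Ar p * Az p, e2 + f * (Az p) ^ 2, f * Az p;
     f * Ar p, f * Az p, f]

/-- Gaussian curvature of the conformally flat 2-metric e^{2λ}(dρ²+dz²). -/
def gaussConf (lam : ℝ × ℝ → ℝ) (p : ℝ × ℝ) : ℝ := -exp (-2 * lam p) * lapRZ lam p

open scoped Topology

theorem pr_add {f g : ℝ × ℝ → ℝ} {p : ℝ × ℝ} (hf : DifferentiableAt ℝ f p)
    (hg : DifferentiableAt ℝ g p) : pr (fun q => f q + g q) p = pr f p + pr g p := by
  simp [pr, fderiv_fun_add hf hg]

theorem pz_add {f g : ℝ × ℝ → ℝ} {p : ℝ × ℝ} (hf : DifferentiableAt ℝ f p)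
    (hg : DifferentiableAt ℝ g p) : pz (fun q => f q + g q) p = pz f p + pz g p := by
  simp [pz, fderiv_fun_add hf hg]

theorem pr_sub {f g : ℝ × ℝ → ℝ} {p : ℝ × ℝ} (hf : DifferentiableAt ℝ f p)
    (hg : DifferentiableAt ℝ g p) : pr (fun q => f q - g q) p = pr f p - pr g p := by
  simp [pr, fderiv_fun_sub hf hg]

theorem pz_sub {f g : ℝ × ℝ → ℝ} {p : ℝ × ℝ} (hf : DifferentiableAt ℝ f p)
    (hg : DifferentiableAt ℝ g p) : pz (fun q => f q - g q) p = pz f p - pz g p := by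
  simp [pz, fderiv_fun_sub hf hg]

theorem pr_neg (f : ℝ × ℝ → ℝ) (p : ℝ × ℝ) : pr (fun q => -f q) p = -pr f p := by
  simp [pr, fderiv_fun_neg]

theorem pz_neg (f : ℝ × ℝ → ℝ) (p : ℝ × ℝ) : pz (fun q => -f q) p = -pz f p := by
  simp [pz, fderiv_fun_neg]

theorem pr_mul {f g : ℝ × ℝ → ℝ} {p : ℝ × ℝ} (hf : DifferentiableAt ℝ f p)
    (hg : DifferentiableAt ℝ g p) :
    pr (fun q => f q * g q) p = pr f p * g p + f p * pr g p := by
  simp [pr, fderiv_fun_mul hf hg]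
  ring

theorem pz_mul {f g : ℝ × ℝ → ℝ} {p : ℝ × ℝ} (hf : DifferentiableAt ℝ f p)
    (hg : DifferentiableAt ℝ g p) :
    pz (fun q => f q * g q) p = pz f p * g p + f p * pz g p := by
  simp [pz, fderiv_fun_mul hf hg]
  ring

theorem pr_const (c : ℝ) (p : ℝ × ℝ) : pr (fun _ => c) p = 0 := by
  simp [pr]

theorem pz_const (c : ℝ) (p : ℝ × ℝ) : pz (fun _ => c) p = 0 := by
  simp [pz]

theorem pr_exp {f : ℝ × ℝ → ℝ} {p : ℝ × ℝ} (hf : DifferentiableAt ℝ f p) :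
    pr (fun q => exp (f q)) p = exp (f p) * pr f p := by
  simp [pr, fderiv_exp hf]

theorem pz_exp {f : ℝ × ℝ → ℝ} {p : ℝ × ℝ} (hf : DifferentiableAt ℝ f p) :
    pz (fun q => exp (f q)) p = exp (f p) * pz f p := by
  simp [pz, fderiv_exp hf]

theorem pr_congr {f g : ℝ × ℝ → ℝ} {p : ℝ × ℝ} (h : f =ᶠ[𝓝 p] g) : pr f p = pr g p := by
  simp only [pr, h.fderiv_eq]

theorem pz_congr {f g : ℝ × ℝ → ℝ} {p : ℝ × ℝ} (h : f =ᶠ[𝓝 p] g) : pz f p = pz g p := by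
  simp only [pz, h.fderiv_eq]

theorem ContDiffAt.differentiableAt_pr {f : ℝ × ℝ → ℝ} {p : ℝ × ℝ} (hf : ContDiffAt ℝ 2 f p) :
    DifferentiableAt ℝ (pr f) p :=
  ((hf.fderiv_right (m := 1) (by norm_num)).differentiableAt (by norm_num)).clm_apply
    (differentiableAt_const _)

theorem ContDiffAt.differentiableAt_pz {f : ℝ × ℝ → ℝ} {p : ℝ × ℝ} (hf : ContDiffAt ℝ 2 f p) :
    DifferentiableAt ℝ (pz f) p :=
  ((hf.fderiv_right (m := 1) (by norm_num)).differentiableAt (by norm_num)).clm_apply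
    (differentiableAt_const _)

/-- Mixed partial derivatives commute. -/
theorem pz_pr_comm {f : ℝ × ℝ → ℝ} {p : ℝ × ℝ} (hf : ContDiffAt ℝ 2 f p) :
    pz (pr f) p = pr (pz f) p := by
  have hd : DifferentiableAt ℝ (fderiv ℝ f) p :=
    (hf.fderiv_right (m := 1) (by norm_num)).differentiableAt (by norm_num)
  have hs := (hf.isSymmSndFDerivAt (by simp)).eq (0, 1) (1, 0)
  have h1 : pz (pr f) p = fderiv ℝ (fderiv ℝ f) p (0, 1) (1, 0) := by
    unfold pz pr
    rw [fderiv_clm_apply hd (differentiableAt_const _)]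
    simp
  have h2 : pr (pz f) p = fderiv ℝ (fderiv ℝ f) p (1, 0) (0, 1) := by
    unfold pz pr
    rw [fderiv_clm_apply hd (differentiableAt_const _)]
    simp
  rw [h1, h2, hs]

/-- The partial derivatives on ℝ³ of a function which depends on the first two coordinates only. -/
theorem pd3_comp_fst_two {G : ℝ × ℝ → ℝ} {x : Fin 3 → ℝ} (hG : DifferentiableAt ℝ G (x 0, x 1))
    (i : Fin 3) : pd3 i (fun y => G (y 0, y 1)) x = ![pr G (x 0, x 1), pz G (x 0, x 1), 0] i := by
  let L : (Fin 3 → ℝ) →L[ℝ] ℝ × ℝ :=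
    (ContinuousLinearMap.proj 0).prod (ContinuousLinearMap.proj 1)
  have h : HasFDerivAt (fun y : Fin 3 → ℝ => G (y 0, y 1)) ((fderiv ℝ G (x 0, x 1)).comp L) x :=
    HasFDerivAt.comp (g := G) x hG.hasFDerivAt L.hasFDerivAt
  rw [pd3, h.fderiv]
  fin_cases i <;> simp [L, pr, pz, show ((0 : ℝ), (0 : ℝ)) = 0 from rfl]

theorem pd3_congr {f g : (Fin 3 → ℝ) → ℝ} {x : Fin 3 → ℝ} (h : f =ᶠ[𝓝 x] g) (i : Fin 3) :
    pd3 i f x = pd3 i g x := by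
  simp only [pd3, h.fderiv_eq]

theorem christoffel_congr {g g' : (Fin 3 → ℝ) → Matrix (Fin 3) (Fin 3) ℝ} {x : Fin 3 → ℝ}
    (h : g =ᶠ[𝓝 x] g') (k i j : Fin 3) : christoffel g k i j x = christoffel g' k i j x := by
  have hc : ∀ r s : Fin 3, (fun y => g y r s) =ᶠ[𝓝 x] fun y => g' y r s := fun r s =>
    h.mono fun y hy => by simp only [hy]
  simp only [christoffel, h.eq_of_nhds, pd3_congr (hc _ _)]

theorem scalarCurv_congr {g g' : (Fin 3 → ℝ) → Matrix (Fin 3) (Fin 3) ℝ} {x : Fin 3 → ℝ}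
    (h : g =ᶠ[𝓝 x] g') : scalarCurv g x = scalarCurv g' x := by
  have hc : ∀ k i j : Fin 3, christoffel g k i j =ᶠ[𝓝 x] christoffel g' k i j := fun k i j =>
    h.eventuallyEq_nhds.mono fun y hy => christoffel_congr hy k i j
  simp only [scalarCurv, ricci, h.eq_of_nhds, pd3_congr (hc _ _ _), christoffel_congr h]

/-- The entries of the metric e^{2l}(dρ²+dz²) + e^{2m}(dφ + a dρ + b dz)². -/
def kkEntry (l m a b : ℝ × ℝ → ℝ) (i j : Fin 3) (p : ℝ × ℝ) : ℝ :=
  !![exp (2 * l p) + exp (2 * m p) * (a p * a p), exp (2 * m p) * (a p * b p), exp (2 * m p) * a p;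
     exp (2 * m p) * (a p * b p), exp (2 * l p) + exp (2 * m p) * (b p * b p), exp (2 * m p) * b p;
     exp (2 * m p) * a p, exp (2 * m p) * b p, exp (2 * m p)] i j

/-- The metric e^{2l}(dρ²+dz²) + e^{2m}(dφ + a dρ + b dz)² on ℝ³. -/
def kkMetric (l m a b : ℝ × ℝ → ℝ) (x : Fin 3 → ℝ) : Matrix (Fin 3) (Fin 3) ℝ :=
  Matrix.of fun i j => kkEntry l m a b i j (x 0, x 1)

theorem inv_kkMetric (l m a b : ℝ × ℝ → ℝ) (x : Fin 3 → ℝ) :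
    (kkMetric l m a b x)⁻¹ =
      let p : ℝ × ℝ := (x 0, x 1)
      let E : ℝ := (exp (2 * l p))⁻¹
      !![E, 0, -(E * a p); 0, E, -(E * b p);
        -(E * a p), -(E * b p), (exp (2 * m p))⁻¹ + E * (a p * a p + b p * b p)] := by
  apply Matrix.inv_eq_right_inv
  have hE := (exp_pos (2 * l (x 0, x 1))).ne'
  have hF := (exp_pos (2 * m (x 0, x 1))).ne'
  ext i j
  fin_cases i <;> fin_cases j <;>
    simp [kkMetric, kkEntry, Matrix.mul_apply, Fin.sum_univ_three] <;> field_simp <;> ring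

/-- Christoffel symbols Γᵏᵢⱼ of the metric `kkMetric l m a b`, for `k` one of the indices 0, 1. -/
def kkGammaBase (l m a b : ℝ × ℝ → ℝ) (k i j : Fin 3) (p : ℝ × ℝ) : ℝ :=
  ![ ![![pr l p - exp (2 * m p - 2 * l p) * (pr m p * (a p * a p)),
         pz l p + exp (2 * m p - 2 * l p) *
          (1 / 2 * (a p * (pz a p - pr b p)) - pr m p * (a p * b p)),
         -(exp (2 * m p - 2 * l p) * (pr m p * a p))],
       ![pz l p + exp (2 * m p - 2 * l p) *
          (1 / 2 * (a p * (pz a p - pr b p)) - pr m p * (a p * b p)),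
         -pr l p + exp (2 * m p - 2 * l p) *
          (b p * (pz a p - pr b p) - pr m p * (b p * b p)),
         exp (2 * m p - 2 * l p) * (1 / 2 * (pz a p - pr b p) - pr m p * b p)],
       ![-(exp (2 * m p - 2 * l p) * (pr m p * a p)),
         exp (2 * m p - 2 * l p) * (1 / 2 * (pz a p - pr b p) - pr m p * b p),
         -(exp (2 * m p - 2 * l p) * pr m p)]],
     ![![-pz l p + exp (2 * m p - 2 * l p) *
          (a p * (pr b p - pz a p) - pz m p * (a p * a p)),
         pr l p + exp (2 * m p - 2 * l p) *
          (1 / 2 * (b p * (pr b p - pz a p)) - pz m p * (a p * b p)),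
         exp (2 * m p - 2 * l p) * (1 / 2 * (pr b p - pz a p) - pz m p * a p)],
       ![pr l p + exp (2 * m p - 2 * l p) *
          (1 / 2 * (b p * (pr b p - pz a p)) - pz m p * (a p * b p)),
         pz l p - exp (2 * m p - 2 * l p) * (pz m p * (b p * b p)),
         -(exp (2 * m p - 2 * l p) * (pz m p * b p))],
       ![exp (2 * m p - 2 * l p) * (1 / 2 * (pr b p - pz a p) - pz m p * a p),
         -(exp (2 * m p - 2 * l p) * (pz m p * b p)),
         -(exp (2 * m p - 2 * l p) * pz m p)]],
     0] k i j

/-- Christoffel symbols Γᵏᵢⱼ of the metric `kkMetric l m a b`. -/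
def kkGamma (l m a b : ℝ × ℝ → ℝ) (k i j : Fin 3) (p : ℝ × ℝ) : ℝ :=
  ![kkGammaBase l m a b 0 i j p, kkGammaBase l m a b 1 i j p,
    !![pr a p + 2 * (pr m p * a p), 1 / 2 * (pr b p + pz a p) + pr m p * b p + pz m p * a p, pr m p;
       1 / 2 * (pr b p + pz a p) + pr m p * b p + pz m p * a p, pz b p + 2 * (pz m p * b p), pz m p;
       pr m p, pz m p, 0] i j
      - a p * kkGammaBase l m a b 0 i j p - b p * kkGammaBase l m a b 1 i j p] k

theorem differentiableAt_kkEntry {l m a b : ℝ × ℝ → ℝ} {p : ℝ × ℝ}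
    (hl : DifferentiableAt ℝ l p) (hm : DifferentiableAt ℝ m p)
    (ha : DifferentiableAt ℝ a p) (hb : DifferentiableAt ℝ b p) (i j : Fin 3) :
    DifferentiableAt ℝ (kkEntry l m a b i j) p := by
  unfold kkEntry
  fin_cases i <;> fin_cases j <;> simp <;> fun_prop

set_option maxHeartbeats 4000000 in
theorem christoffel_kkMetric {l m a b : ℝ × ℝ → ℝ} {x : Fin 3 → ℝ}
    (hl : DifferentiableAt ℝ l (x 0, x 1)) (hm : DifferentiableAt ℝ m (x 0, x 1))
    (ha : DifferentiableAt ℝ a (x 0, x 1)) (hb : DifferentiableAt ℝ b (x 0, x 1))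
    (k i j : Fin 3) :
    christoffel (kkMetric l m a b) k i j x = kkGamma l m a b k i j (x 0, x 1) := by
  have hpd : ∀ r s t : Fin 3, pd3 r (fun y => kkMetric l m a b y s t) x =
      ![pr (kkEntry l m a b s t) (x 0, x 1), pz (kkEntry l m a b s t) (x 0, x 1), 0] r :=
    fun r s t => pd3_comp_fst_two (differentiableAt_kkEntry hl hm ha hb s t) r
  simp only [christoffel, inv_kkMetric, hpd, Fin.sum_univ_three]
  generalize (x 0, x 1) = p at *
  have hE := (exp_pos (2 * l p)).ne'
  have hF := (exp_pos (2 * m p)).ne'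
  have h00 : kkEntry l m a b 0 0 = fun p => exp (2 * l p) + exp (2 * m p) * (a p * a p) := rfl
  have h01 : kkEntry l m a b 0 1 = fun p => exp (2 * m p) * (a p * b p) := rfl
  have h02 : kkEntry l m a b 0 2 = fun p => exp (2 * m p) * a p := rfl
  have h10 : kkEntry l m a b 1 0 = fun p => exp (2 * m p) * (a p * b p) := rfl
  have h11 : kkEntry l m a b 1 1 = fun p => exp (2 * l p) + exp (2 * m p) * (b p * b p) := rfl
  have h12 : kkEntry l m a b 1 2 = fun p => exp (2 * m p) * b p := rfl
  have h20 : kkEntry l m a b 2 0 = fun p => exp (2 * m p) * a p := rfl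
  have h21 : kkEntry l m a b 2 1 = fun p => exp (2 * m p) * b p := rfl
  have h22 : kkEntry l m a b 2 2 = fun p => exp (2 * m p) := rfl
  fin_cases k <;> fin_cases i <;> fin_cases j <;>
    simp (disch := fun_prop) [h00, h01, h02, h10, h11, h12, h20, h21, h22, pr_add, pz_add, pr_mul,
      pz_mul, pr_exp, pz_exp, pr_const, pz_const, kkGamma, kkGammaBase, exp_sub] <;>
    field_simp <;> ring

set_option maxHeartbeats 4000000 in
theorem differentiableAt_kkGamma {l m a b : ℝ × ℝ → ℝ} {p : ℝ × ℝ} (hl : ContDiffAt ℝ 2 l p)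
    (hm : ContDiffAt ℝ 2 m p) (ha : ContDiffAt ℝ 2 a p) (hb : ContDiffAt ℝ 2 b p)
    (k i j : Fin 3) : DifferentiableAt ℝ (kkGamma l m a b k i j) p := by
  have dl := hl.differentiableAt (by norm_num)
  have dm := hm.differentiableAt (by norm_num)
  have da := ha.differentiableAt (by norm_num)
  have db := hb.differentiableAt (by norm_num)
  have dlr := hl.differentiableAt_pr
  have dmr := hm.differentiableAt_pr
  have dar := ha.differentiableAt_pr
  have dbr := hb.differentiableAt_pr
  have dlz := hl.differentiableAt_pz
  have dmz := hm.differentiableAt_pz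
  have daz := ha.differentiableAt_pz
  have dbz := hb.differentiableAt_pz
  have hbase : ∀ k i j, DifferentiableAt ℝ (kkGammaBase l m a b k i j) p := by
    intro k i j
    unfold kkGammaBase
    fin_cases k <;> fin_cases i <;> fin_cases j <;> simp <;> fun_prop
  unfold kkGamma
  fin_cases k
  · exact hbase 0 i j
  · exact hbase 1 i j
  · have h0 := hbase 0 i j
    have h1 := hbase 1 i j
    refine ((?_ : DifferentiableAt ℝ _ p).sub (da.mul h0)).sub (db.mul h1)
    fin_cases i <;> fin_cases j <;> simp <;> fun_prop

theorem ricci_kkMetric {l m a b : ℝ × ℝ → ℝ} {x : Fin 3 → ℝ}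
    (hl : ContDiffAt ℝ 2 l (x 0, x 1)) (hm : ContDiffAt ℝ 2 m (x 0, x 1))
    (ha : ContDiffAt ℝ 2 a (x 0, x 1)) (hb : ContDiffAt ℝ 2 b (x 0, x 1)) (i j : Fin 3) :
    ricci (kkMetric l m a b) i j x =
      pr (kkGamma l m a b 0 i j) (x 0, x 1) + pz (kkGamma l m a b 1 i j) (x 0, x 1)
      - ∑ k, ![pr (kkGamma l m a b k i k) (x 0, x 1), pz (kkGamma l m a b k i k) (x 0, x 1), 0] j
      + ∑ k, ∑ n, (kkGamma l m a b k k n (x 0, x 1) * kkGamma l m a b n i j (x 0, x 1)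
        - kkGamma l m a b k j n (x 0, x 1) * kkGamma l m a b n i k (x 0, x 1)) := by
  have hev : ∀ᶠ q in 𝓝 (x 0, x 1), ∀ k i j : Fin 3, ∀ y : Fin 3 → ℝ, (y 0, y 1) = q →
      christoffel (kkMetric l m a b) k i j y = kkGamma l m a b k i j (y 0, y 1) := by
    filter_upwards [hl.eventually (by simp), hm.eventually (by simp), ha.eventually (by simp),
      hb.eventually (by simp)] with q h1 h2 h3 h4 k i j y hy
    subst hy
    exact christoffel_kkMetric (h1.differentiableAt (by norm_num))
      (h2.differentiableAt (by norm_num)) (h3.differentiableAt (by norm_num))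
      (h4.differentiableAt (by norm_num)) k i j
  have hcont : Filter.Tendsto (fun y : Fin 3 → ℝ => (y 0, y 1)) (𝓝 x) (𝓝 (x 0, x 1)) :=
    Continuous.tendsto (by fun_prop) x
  have hΓ : ∀ k i j : Fin 3, christoffel (kkMetric l m a b) k i j =ᶠ[𝓝 x]
      fun y => kkGamma l m a b k i j (y 0, y 1) := fun k i j =>
    (hcont.eventually hev).mono fun y hy => hy k i j y rfl
  have hd : ∀ k i j n : Fin 3, pd3 n (christoffel (kkMetric l m a b) k i j) x =
      ![pr (kkGamma l m a b k i j) (x 0, x 1), pz (kkGamma l m a b k i j) (x 0, x 1), 0] n :=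
    fun k i j n => (pd3_congr (hΓ k i j) n).trans
      (pd3_comp_fst_two (differentiableAt_kkGamma hl hm ha hb k i j) n)
  have hv : ∀ k i j : Fin 3, christoffel (kkMetric l m a b) k i j x =
      kkGamma l m a b k i j (x 0, x 1) := fun k i j => (hΓ k i j).eq_of_nhds
  simp only [ricci, hd, hv]
  simp [Fin.sum_univ_three]

set_option maxHeartbeats 4000000 in
theorem ricci_kkMetric_two_two {l m a b : ℝ × ℝ → ℝ} {x : Fin 3 → ℝ}
    (hl : ContDiffAt ℝ 2 l (x 0, x 1)) (hm : ContDiffAt ℝ 2 m (x 0, x 1))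
    (ha : ContDiffAt ℝ 2 a (x 0, x 1)) (hb : ContDiffAt ℝ 2 b (x 0, x 1)) :
    ricci (kkMetric l m a b) 2 2 x =
      let p : ℝ × ℝ := (x 0, x 1);
      let W : ℝ := exp (2 * m p - 2 * l p);
      -W * (lapRZ m p + pr m p ^ 2 + pz m p ^ 2) + 1 / 2 * W ^ 2 * (pz a p - pr b p) ^ 2 := by
  rw [ricci_kkMetric hl hm ha hb]
  generalize (x 0, x 1) = p at *
  have dl := hl.differentiableAt (by norm_num)
  have dm := hm.differentiableAt (by norm_num)
  have da := ha.differentiableAt (by norm_num)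
  have db := hb.differentiableAt (by norm_num)
  have dlr := hl.differentiableAt_pr
  have dmr := hm.differentiableAt_pr
  have dar := ha.differentiableAt_pr
  have dbr := hb.differentiableAt_pr
  have dlz := hl.differentiableAt_pz
  have dmz := hm.differentiableAt_pz
  have daz := ha.differentiableAt_pz
  have dbz := hb.differentiableAt_pz
  unfold kkGamma kkGammaBase
  simp (disch := fun_prop) [pr_sub, pz_sub, pr_neg, pz_neg, pr_mul,
      pz_mul, pr_exp, pz_exp, pr_const, pz_const, Fin.sum_univ_three, lapRZ]
  ring

set_option maxHeartbeats 4000000 in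
theorem ricci_kkMetric_horizontal_zero {l m a b : ℝ × ℝ → ℝ} {x : Fin 3 → ℝ}
    (hl : ContDiffAt ℝ 2 l (x 0, x 1)) (hm : ContDiffAt ℝ 2 m (x 0, x 1))
    (ha : ContDiffAt ℝ 2 a (x 0, x 1)) (hb : ContDiffAt ℝ 2 b (x 0, x 1)) :
    ricci (kkMetric l m a b) 0 0 x - a (x 0, x 1) * (ricci (kkMetric l m a b) 0 2 x
        + ricci (kkMetric l m a b) 2 0 x) + a (x 0, x 1) ^ 2 * ricci (kkMetric l m a b) 2 2 x =
      let p : ℝ × ℝ := (x 0, x 1);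
      let W : ℝ := exp (2 * m p - 2 * l p);
      -lapRZ l p - (pr (pr m) p - pr l p * pr m p + pz l p * pz m p + pr m p ^ 2)
        - 1 / 2 * W * (pz a p - pr b p) ^ 2 := by
  simp only [ricci_kkMetric hl hm ha hb]
  generalize (x 0, x 1) = p at *
  have dl := hl.differentiableAt (by norm_num)
  have dm := hm.differentiableAt (by norm_num)
  have da := ha.differentiableAt (by norm_num)
  have db := hb.differentiableAt (by norm_num)
  have dlr := hl.differentiableAt_pr
  have dmr := hm.differentiableAt_pr
  have dar := ha.differentiableAt_pr
  have dbr := hb.differentiableAt_pr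
  have dlz := hl.differentiableAt_pz
  have dmz := hm.differentiableAt_pz
  have daz := ha.differentiableAt_pz
  have dbz := hb.differentiableAt_pz
  unfold kkGamma kkGammaBase
  simp (disch := fun_prop) [pr_add, pz_add, pr_sub, pz_sub, pr_neg, pz_neg, pr_mul,
      pz_mul, pr_exp, pz_exp, pr_const, pz_const, Fin.sum_univ_three, pz_pr_comm hb, lapRZ]
  ring

set_option maxHeartbeats 4000000 in
theorem ricci_kkMetric_horizontal_one {l m a b : ℝ × ℝ → ℝ} {x : Fin 3 → ℝ}
    (hl : ContDiffAt ℝ 2 l (x 0, x 1)) (hm : ContDiffAt ℝ 2 m (x 0, x 1))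
    (ha : ContDiffAt ℝ 2 a (x 0, x 1)) (hb : ContDiffAt ℝ 2 b (x 0, x 1)) :
    ricci (kkMetric l m a b) 1 1 x - b (x 0, x 1) * (ricci (kkMetric l m a b) 1 2 x
        + ricci (kkMetric l m a b) 2 1 x) + b (x 0, x 1) ^ 2 * ricci (kkMetric l m a b) 2 2 x =
      let p : ℝ × ℝ := (x 0, x 1);
      let W : ℝ := exp (2 * m p - 2 * l p);
      -lapRZ l p - (pz (pz m) p + pr l p * pr m p - pz l p * pz m p + pz m p ^ 2)
        - 1 / 2 * W * (pz a p - pr b p) ^ 2 := by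
  simp only [ricci_kkMetric hl hm ha hb]
  generalize (x 0, x 1) = p at *
  have dl := hl.differentiableAt (by norm_num)
  have dm := hm.differentiableAt (by norm_num)
  have da := ha.differentiableAt (by norm_num)
  have db := hb.differentiableAt (by norm_num)
  have dlr := hl.differentiableAt_pr
  have dmr := hm.differentiableAt_pr
  have dar := ha.differentiableAt_pr
  have dbr := hb.differentiableAt_pr
  have dlz := hl.differentiableAt_pz
  have dmz := hm.differentiableAt_pz
  have daz := ha.differentiableAt_pz
  have dbz := hb.differentiableAt_pz
  unfold kkGamma kkGammaBase
  simp (disch := fun_prop) [pr_add, pz_add, pr_sub, pz_sub, pr_neg, pz_neg, pr_mul,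
      pz_mul, pr_exp, pz_exp, pr_const, pz_const, Fin.sum_univ_three, pz_pr_comm hm, pz_pr_comm hb, lapRZ]
  ring

/-- The scalar curvature of the metric e^{2l}(dρ²+dz²) + e^{2m}(dφ + a dρ + b dz)². -/
theorem scalarCurv_kkMetric {l m a b : ℝ × ℝ → ℝ} {x : Fin 3 → ℝ}
    (hl : ContDiffAt ℝ 2 l (x 0, x 1)) (hm : ContDiffAt ℝ 2 m (x 0, x 1))
    (ha : ContDiffAt ℝ 2 a (x 0, x 1)) (hb : ContDiffAt ℝ 2 b (x 0, x 1)) :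
    exp (2 * l (x 0, x 1)) * scalarCurv (kkMetric l m a b) x =
      let p : ℝ × ℝ := (x 0, x 1);
      -2 * lapRZ l p - 2 * (lapRZ m p + pr m p ^ 2 + pz m p ^ 2)
        - 1 / 2 * exp (2 * m p - 2 * l p) * (pz a p - pr b p) ^ 2 := by
  have h22 := ricci_kkMetric_two_two hl hm ha hb
  have h0 := ricci_kkMetric_horizontal_zero hl hm ha hb
  have h1 := ricci_kkMetric_horizontal_one hl hm ha hb
  simp only [scalarCurv, inv_kkMetric, Fin.sum_univ_three] at *
  simp only [lapRZ, exp_sub] at *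
  generalize (x 0, x 1) = p at *
  have hE := (exp_pos (2 * l p)).ne'
  have hF := (exp_pos (2 * m p)).ne'
  have key : exp (2 * l p) * ((exp (2 * m p))⁻¹ * ricci (kkMetric l m a b) 2 2 x) =
      -(pr (pr m) p + pz (pz m) p + pr m p ^ 2 + pz m p ^ 2)
        + 1 / 2 * (exp (2 * m p) / exp (2 * l p)) * (pz a p - pr b p) ^ 2 := by
    rw [h22]
    field_simp
  have hinv : exp (2 * l p) * (exp (2 * l p))⁻¹ = 1 := mul_inv_cancel₀ hE
  simp
  linear_combination h0 + h1 + key + (ricci (kkMetric l m a b) 0 0 x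
    + ricci (kkMetric l m a b) 1 1 x - a p * (ricci (kkMetric l m a b) 0 2 x
    + ricci (kkMetric l m a b) 2 0 x) - b p * (ricci (kkMetric l m a b) 1 2 x
    + ricci (kkMetric l m a b) 2 1 x)
    + (a p ^ 2 + b p ^ 2) * ricci (kkMetric l m a b) 2 2 x) * hinv

theorem contDiffAt_log_fst {p : ℝ × ℝ} (hp : 0 < p.1) :
    ContDiffAt ℝ 2 (fun q : ℝ × ℝ => log q.1) p :=
  contDiffAt_fst.log hp.ne'

theorem pr_log_fst {p : ℝ × ℝ} (hp : 0 < p.1) : pr (fun q => log q.1) p = p.1⁻¹ := by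
  have h : HasFDerivAt (fun q : ℝ × ℝ => log q.1) (p.1⁻¹ • ContinuousLinearMap.fst ℝ ℝ ℝ) p :=
    hasFDerivAt_fst.log hp.ne'
  simp [pr, h.fderiv]

theorem pz_log_fst {p : ℝ × ℝ} (hp : 0 < p.1) : pz (fun q => log q.1) p = 0 := by
  have h : HasFDerivAt (fun q : ℝ × ℝ => log q.1) (p.1⁻¹ • ContinuousLinearMap.fst ℝ ℝ ℝ) p :=
    hasFDerivAt_fst.log hp.ne'
  simp [pz, h.fderiv]

theorem eventually_fst_pos {p : ℝ × ℝ} (hp : 0 < p.1) : ∀ᶠ q : ℝ × ℝ in 𝓝 p, 0 < q.1 :=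
  continuousAt_fst.eventually (lt_mem_nhds hp)

theorem lapRZ_log_fst {p : ℝ × ℝ} (hp : 0 < p.1) :
    lapRZ (fun q => log q.1) p = -(p.1 ^ 2)⁻¹ := by
  have hr : pr (fun q => log q.1) =ᶠ[𝓝 p] fun q => q.1⁻¹ :=
    (eventually_fst_pos hp).mono fun q hq => pr_log_fst hq
  have hz : pz (fun q => log q.1) =ᶠ[𝓝 p] fun _ => 0 :=
    (eventually_fst_pos hp).mono fun q hq => pz_log_fst hq
  have h : HasFDerivAt (fun q : ℝ × ℝ => q.1⁻¹)
      (-(p.1 ^ 2)⁻¹ • ContinuousLinearMap.fst ℝ ℝ ℝ) p :=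
    (hasDerivAt_inv hp.ne').comp_hasFDerivAt p hasFDerivAt_fst
  rw [lapRZ, pr_congr hr, pz_congr hz, pz_const, pr, h.fderiv]
  simp

theorem lapRZ_sub {f g : ℝ × ℝ → ℝ} {p : ℝ × ℝ} (hf : ContDiffAt ℝ 2 f p)
    (hg : ContDiffAt ℝ 2 g p) : lapRZ (fun q => f q - g q) p = lapRZ f p - lapRZ g p := by
  have hev : ∀ᶠ q in 𝓝 p, DifferentiableAt ℝ f q ∧ DifferentiableAt ℝ g q := by
    filter_upwards [hf.eventually (by simp), hg.eventually (by simp)] with q h1 h2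
    exact ⟨h1.differentiableAt (by norm_num), h2.differentiableAt (by norm_num)⟩
  have hr : pr (fun q => f q - g q) =ᶠ[𝓝 p] fun q => pr f q - pr g q :=
    hev.mono fun q hq => pr_sub hq.1 hq.2
  have hz : pz (fun q => f q - g q) =ᶠ[𝓝 p] fun q => pz f q - pz g q :=
    hev.mono fun q hq => pz_sub hq.1 hq.2
  rw [lapRZ, pr_congr hr, pz_congr hz, pr_sub hf.differentiableAt_pr hg.differentiableAt_pr,
    pz_sub hf.differentiableAt_pz hg.differentiableAt_pz, lapRZ, lapRZ]
  ring

theorem brillMetric_eq_kkMetric (U α Ar Az : ℝ × ℝ → ℝ) {x : Fin 3 → ℝ} (hx : 0 < x 0) :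
    brillMetric U α Ar Az x =
      kkMetric (fun q => α q - U q) (fun q => log q.1 - U q) Ar Az x := by
  have h1 : exp (2 * (α (x 0, x 1) - U (x 0, x 1))) =
      exp (-2 * U (x 0, x 1) + 2 * α (x 0, x 1)) := by
    congr 1
    ring
  have h2 : exp (2 * (log (x 0) - U (x 0, x 1))) = x 0 ^ 2 * exp (-2 * U (x 0, x 1)) := by
    rw [show 2 * (log (x 0) - U (x 0, x 1)) = log (x 0) + log (x 0) + -2 * U (x 0, x 1) by ring,
      exp_add, exp_add, exp_log hx]
    ring
  ext i j
  simp only [kkMetric, kkEntry, brillMetric, Matrix.of_apply, h1, h2]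
  fin_cases i <;> fin_cases j <;> simp [sq] <;> ring

theorem brill_U_equation (U α Ar Az : ℝ × ℝ → ℝ)
    (hU : ContDiff ℝ (⊤ : ℕ∞) U) (hα : ContDiff ℝ (⊤ : ℕ∞) α)
    (hAr : ContDiff ℝ (⊤ : ℕ∞) Ar) (hAz : ContDiff ℝ (⊤ : ℕ∞) Az)
    (x : Fin 3 → ℝ) (hρ : 0 < x 0) :
    lapRZ U (x 0, x 1) =
      (1 / 2) * exp (-2 * U (x 0, x 1) + 2 * α (x 0, x 1)) *
          scalarCurv (brillMetric U α Ar Az) x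
        - (2 / x 0) * pr U (x 0, x 1)
        + ((pr U (x 0, x 1)) ^ 2 + (pz U (x 0, x 1)) ^ 2)
        + ((x 0) ^ 2 / 4) * exp (-2 * α (x 0, x 1)) *
            (pz Ar (x 0, x 1) - pr Az (x 0, x 1)) ^ 2
        - exp (-2 * U (x 0, x 1) + 2 * α (x 0, x 1)) *
            gaussConf (fun q => α q - U q) (x 0, x 1) := by
  set p : ℝ × ℝ := (x 0, x 1) with hp
  have hp1 : 0 < p.1 := hρ
  have cU : ContDiffAt ℝ 2 U p := hU.contDiffAt.of_le (WithTop.coe_le_coe.mpr le_top)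
  have cα : ContDiffAt ℝ 2 α p := hα.contDiffAt.of_le (WithTop.coe_le_coe.mpr le_top)
  have cAr : ContDiffAt ℝ 2 Ar p := hAr.contDiffAt.of_le (WithTop.coe_le_coe.mpr le_top)
  have cAz : ContDiffAt ℝ 2 Az p := hAz.contDiffAt.of_le (WithTop.coe_le_coe.mpr le_top)
  have clog := contDiffAt_log_fst hp1
  have hg : brillMetric U α Ar Az =ᶠ[𝓝 x]
      kkMetric (fun q => α q - U q) (fun q => log q.1 - U q) Ar Az :=
    ((continuous_apply 0).continuousAt.eventually (lt_mem_nhds hρ)).mono fun y hy =>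
      brillMetric_eq_kkMetric U α Ar Az hy
  have key := scalarCurv_kkMetric (x := x) (cα.sub cU) (clog.sub cU) cAr cAz
  have dU := cU.differentiableAt (by norm_num)
  have dlog := clog.differentiableAt (by norm_num)
  simp only [← hp] at key
  rw [lapRZ_sub cα cU, lapRZ_sub clog cU, pr_sub dlog dU, pz_sub dlog dU, lapRZ_log_fst hp1,
    pr_log_fst hp1, pz_log_fst hp1] at key
  have hE : exp (2 * (α p - U p)) = exp (-2 * U p + 2 * α p) := by
    congr 1
    ring
  have hW : exp (2 * (log p.1 - U p) - 2 * (α p - U p)) = p.1 ^ 2 * exp (-2 * α p) := by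
    rw [show 2 * (log p.1 - U p) - 2 * (α p - U p) = log p.1 + log p.1 + -2 * α p by ring,
      exp_add, exp_add, exp_log hp1]
    ring
  have hK : exp (-2 * U p + 2 * α p) * exp (-2 * (α p - U p)) = 1 := by
    rw [← exp_add, ← exp_zero]
    congr 1
    ring
  rw [hE, hW] at key
  rw [scalarCurv_congr hg, gaussConf, lapRZ_sub cα cU]
  have hx0 : x 0 = p.1 := rfl
  rw [hx0]
  have hne := hp1.ne'
  have hsq : (p.1 ^ 2)⁻¹ = p.1⁻¹ ^ 2 := (inv_pow _ _).symm
  rw [hsq] at key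
  rw [div_eq_mul_inv 2 p.1]
  linear_combination -(1 / 2) * key - (lapRZ α p - lapRZ U p) * hK

end
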